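/- arXiv:2007.08086 — 4 statements merged into one kernel-verified Lean document; each statement's English description precedes it below -/
import Mathlib

section
/- Suppose the total available PFR reserve plus FFR reserve covers the outage, i.e. r_1 + … + r_n + b̃ ≥ L; the post-contingency inertia satisfies M ≥ ε·L·ω0/(2·Δ2); and every generator's available PFR reserve satisfies the rate-based PFR reserve limit r_i ≤ κ_i·h(M, b̃) for all i ∈ {1,…,n}. Then the frequency trajectory satisfies ω(t) ≥ ω_min for all t ≥ 0. -/
open scoped Classical

/-- `c(M) := ω0·ε·L/(2M)`. -/
noncomputable def cFun (ω0 ε L M : ℝ) : ℝ := ω0 * ε * L / (2 * M)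

/-- The limit function
`h(M, b̃) := (4M/ω0)·(Δ2 + Δ3 − c(M))²·(L − b̃) /
  (b̃·√Δ3 − √((Δ2 + Δ3 − c(M))·L² − (Δ2 − c(M))·b̃²))²`. -/
noncomputable def limitFun (ω0 Δ2 Δ3 ε L M b : ℝ) : ℝ :=
  (4 * M / ω0) * (Δ2 + Δ3 - cFun ω0 ε L M) ^ 2 * (L - b) /
    (b * Real.sqrt Δ3 -
      Real.sqrt ((Δ2 + Δ3 - cFun ω0 ε L M) * L ^ 2 - (Δ2 - cFun ω0 ε L M) * b ^ 2)) ^ 2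

/-- If `G` grows at most as fast as `f` on `(x, y)`, then so do its increments. -/
lemma sub_le_sub_of_hasDerivAt_le {f G f' G' : ℝ → ℝ} {x y : ℝ} (hxy : x ≤ y)
    (hf : ContinuousOn f (Set.Icc x y)) (hG : ∀ t, HasDerivAt G (G' t) t)
    (hf' : ∀ t ∈ Set.Ioo x y, HasDerivAt f (f' t) t)
    (hle : ∀ t ∈ Set.Ioo x y, G' t ≤ f' t) : G y - G x ≤ f y - f x := by
  have hmono : MonotoneOn (fun t => f t - G t) (Set.Icc x y) := by
    refine monotoneOn_of_hasDerivWithinAt_nonneg (f' := fun t => f' t - G' t)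
      (convex_Icc x y) (hf.sub fun t _ => (hG t).continuousAt.continuousWithinAt) ?_ ?_
    · intro t ht
      rw [interior_Icc] at ht
      exact ((hf' t ht).sub (hG t)).hasDerivWithinAt
    · intro t ht
      rw [interior_Icc] at ht
      exact sub_nonneg.2 (hle t ht)
  have := hmono (Set.left_mem_Icc.2 hxy) (Set.right_mem_Icc.2 hxy) hxy
  simp only at this
  linarith

/-- A total reserve `∑ i, r i ≥ R` whose components ramp up within time `h` supplies at least
the fraction `θ` of `R` from time `θ * h` on. -/
lemma mul_le_sum_min_ramp {n : ℕ} {r κ : Fin n → ℝ} {h R θ τ : ℝ}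
    (hr : ∀ i, 0 ≤ r i) (hκ : ∀ i, 0 < κ i) (hlim : ∀ i, r i ≤ κ i * h) (hR : R ≤ ∑ i, r i)
    (hθ0 : 0 ≤ θ) (hθ1 : θ ≤ 1) (hτ : θ * h ≤ τ) :
    R * θ ≤ ∑ i, min (κ i * max τ 0) (r i) := by
  calc R * θ ≤ (∑ i, r i) * θ := mul_le_mul_of_nonneg_right hR hθ0
    _ = ∑ i, r i * θ := Finset.sum_mul ..
    _ ≤ _ := by
      refine Finset.sum_le_sum fun i _ => le_min ?_ (mul_le_of_le_one_right (hr i) hθ1)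
      calc r i * θ ≤ κ i * h * θ := mul_le_mul_of_nonneg_right (hlim i) hθ0
        _ = κ i * (θ * h) := by ring
        _ ≤ κ i * max τ 0 :=
          mul_le_mul_of_nonneg_left (hτ.trans (le_max_left _ _)) (hκ i).le

/-- A function lying strictly above `v` before time `s` is at least `v` at time `s`. -/
lemma le_of_forall_lt_of_continuousOn {f : ℝ → ℝ} {s v : ℝ} (hf : ContinuousOn f (Set.Ici 0))
    (hs : 0 ≤ s) (h0 : v ≤ f 0) (h : ∀ t, 0 ≤ t → t < s → v < f t) : v ≤ f s := by
  rcases hs.eq_or_lt with rfl | hs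
  · exact h0
  · have hc : ContinuousWithinAt f (Set.Ico 0 s) s :=
      (hf s hs.le).mono fun t ht => ht.1
    have hne : (nhdsWithin s (Set.Ico 0 s)).NeBot := by
      rw [← mem_closure_iff_nhdsWithin_neBot, closure_Ico hs.ne]
      exact Set.right_mem_Icc.2 hs.le
    exact ge_of_tendsto hc (eventually_nhdsWithin_of_forall fun t ht => (h t ht.1 ht.2).le)

/-- The ramp duration `h` given by the limit function is characterised by a quadratic equation
for the scaled ramp rate `σ²`, where `h * σ² = (2 / a) * (L - b)` and `a = ω0 / (2 * M)`. -/
lemma exists_sq_root_limitFun {ω0 Δ2 Δ3 ε L M b : ℝ} (hω0 : 0 < ω0) (hM : 0 < M)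
    (hΔ3 : 0 < Δ3) (hb : 0 ≤ b) (hbL : b < L) (hc : cFun ω0 ε L M ≤ Δ2) :
    ∃ σ, 0 < σ ∧ (Δ2 - cFun ω0 ε L M) * σ ^ 2 = L ^ 2 - (b + σ * √Δ3) ^ 2 ∧
      ω0 / (2 * M) * σ ^ 2 * limitFun ω0 Δ2 Δ3 ε L M b = 2 * (L - b) := by
  unfold limitFun
  set D := Δ2 - cFun ω0 ε L M with hD
  have hD0 : 0 ≤ D := sub_nonneg.2 hc
  have hE : Δ2 + Δ3 - cFun ω0 ε L M = D + Δ3 := by rw [hD]; ring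
  rw [hE]
  have hEpos : 0 < D + Δ3 := by linarith
  have hw : √Δ3 ^ 2 = Δ3 := Real.sq_sqrt hΔ3.le
  have hgap : 0 < (D + Δ3) * (L ^ 2 - b ^ 2) :=
    mul_pos hEpos (by nlinarith)
  have hrad : (b * √Δ3) ^ 2 < (D + Δ3) * L ^ 2 - D * b ^ 2 := by
    rw [mul_pow, hw]; linarith
  have hlt : b * √Δ3 < √((D + Δ3) * L ^ 2 - D * b ^ 2) := Real.lt_sqrt_of_sq_lt hrad
  have hR : √((D + Δ3) * L ^ 2 - D * b ^ 2) ^ 2 = (D + Δ3) * L ^ 2 - D * b ^ 2 :=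
    Real.sq_sqrt ((sq_nonneg _).trans hrad.le)
  set R := √((D + Δ3) * L ^ 2 - D * b ^ 2)
  set w := √Δ3
  refine ⟨(R - b * w) / (D + Δ3), div_pos (sub_pos.2 hlt) hEpos, ?_, ?_⟩
  · have key : (D + Δ3) * ((R - b * w) / (D + Δ3)) = R - b * w := by field_simp
    set σ := (R - b * w) / (D + Δ3)
    have hsq : ((D + Δ3) * σ + b * w) ^ 2 = (D + Δ3) * L ^ 2 - D * b ^ 2 := by
      rw [key, ← hR]; ring
    have hmul : (D + Δ3) * (D * σ ^ 2) = (D + Δ3) * (L ^ 2 - (b + σ * w) ^ 2) := by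
      linear_combination hsq + ((D + Δ3) * σ ^ 2 - b ^ 2) * hw
    exact mul_left_cancel₀ hEpos.ne' hmul
  · have hne : b * w - R ≠ 0 := (sub_neg.2 hlt).ne
    field_simp
    ring

/-- Theorem 1 of the paper: suppose the total available PFR reserve plus FFR
reserve covers the outage (`Σᵢ rᵢ + b̃ ≥ L`), the post-contingency inertia satisfies
`M ≥ ε·L·ω0/(2·Δ2)`, and every generator's available PFR reserve satisfies the rate-based
PFR reserve limit `rᵢ ≤ κᵢ·h(M, b̃)`.  Then the frequency trajectory of the dynamic model
satisfies `ω(t) ≥ ω_min` for all `t ≥ 0`.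

The dynamic model: `ω(0) = ω0`; `t1 = sInf S1` where `S1 = {t ≥ 0 | ω(t) ≤ ω0 − Δ1}` and
`t2 = sInf S2` where `S2 = {t ≥ 0 | ω(t) ≤ ω0 − Δ1 − Δ2}` (with `inf ∅ = +∞`, encoded by
branching on nonemptiness); the deployed PFR is
`p(t) = Σᵢ min(κᵢ·max(t − t1 − ε, 0), rᵢ)` (and `0` while the dead-band has never been
reached); and for every `t ≥ 0` with `t ≠ t2`, the swing equation
`ω'(t) = (ω0/(2M))·(p(t) + b̃·1[t ≥ t2] − L)` holds. -/
theorem frequency_above_critical_threshold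
    (ω0 Δ1 Δ2 ωmin ε L M bt : ℝ) (n : ℕ) (r κ : Fin n → ℝ) (ω : ℝ → ℝ)
    (hω0 : 0 < ω0) (hΔ1 : 0 ≤ Δ1) (hΔ2 : 0 < Δ2)
    (hΔ3 : 0 < ω0 - Δ1 - Δ2 - ωmin) (hε : 0 ≤ ε) (hL : 0 < L) (hMpos : 0 < M)
    (hr0 : ∀ i, 0 ≤ r i) (hκ : ∀ i, 0 < κ i) (hb0 : 0 ≤ bt) (hbL : bt < L)
    (hinit : ω 0 = ω0) (hcont : ContinuousOn ω (Set.Ici 0))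
    (S1 S2 : Set ℝ)
    (hS1 : S1 = {t : ℝ | 0 ≤ t ∧ ω t ≤ ω0 - Δ1})
    (hS2 : S2 = {t : ℝ | 0 ≤ t ∧ ω t ≤ ω0 - Δ1 - Δ2})
    (p : ℝ → ℝ)
    (hp : ∀ t : ℝ, p t =
      if S1.Nonempty then ∑ i, min (κ i * max (t - sInf S1 - ε) 0) (r i) else 0)
    (ffr : ℝ → ℝ)
    (hffr : ∀ t : ℝ, ffr t = if S2.Nonempty ∧ sInf S2 ≤ t then bt else 0)
    (hswing : ∀ t : ℝ, 0 ≤ t → (S2.Nonempty → t ≠ sInf S2) →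
      HasDerivAt ω (ω0 / (2 * M) * (p t + ffr t - L)) t)
    (hcover : (∑ i, r i) + bt ≥ L)
    (hinertia : M ≥ ε * L * ω0 / (2 * Δ2))
    (hlimit : ∀ i, r i ≤ κ i * limitFun ω0 Δ2 (ω0 - Δ1 - Δ2 - ωmin) ε L M bt) :
    ∀ t : ℝ, 0 ≤ t → ω t ≥ ωmin := by
  intro t ht
  set Δ3 := ω0 - Δ1 - Δ2 - ωmin with hΔ3_def
  by_cases hne2 : S2.Nonempty
  swap
  · by_contra! hlt
    exact hne2 ⟨t, by rw [hS2]; exact ⟨ht, by linarith⟩⟩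
  have hsub : S2 ⊆ S1 := by
    rw [hS1, hS2]
    exact fun u hu => ⟨hu.1, by linarith [hu.2]⟩
  have hne1 : S1.Nonempty := hne2.mono hsub
  have hbdd1 : BddBelow S1 := ⟨0, fun u hu => by rw [hS1] at hu; exact hu.1⟩
  have hbdd2 : BddBelow S2 := hbdd1.mono hsub
  simp only [hne1, if_true] at hp
  simp only [hne2, true_and] at hffr
  have ht10 : 0 ≤ sInf S1 := le_csInf hne1 fun u hu => by rw [hS1] at hu; exact hu.1
  have ht12 : sInf S1 ≤ sInf S2 := csInf_le_csInf hbdd1 hne2 hsub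
  have hbefore1 : ∀ u, 0 ≤ u → u < sInf S1 → ω0 - Δ1 < ω u := fun u hu hlt => by
    by_contra! hle
    exact notMem_of_lt_csInf hlt hbdd1 (by rw [hS1]; exact ⟨hu, hle⟩)
  have hbefore2 : ∀ u, 0 ≤ u → u < sInf S2 → ω0 - Δ1 - Δ2 < ω u := fun u hu hlt => by
    by_contra! hle
    exact notMem_of_lt_csInf hlt hbdd2 (by rw [hS2]; exact ⟨hu, hle⟩)
  have hclosed2 : IsClosed S2 := by
    have : S2 = Set.Ici 0 ∩ ω ⁻¹' Set.Iic (ω0 - Δ1 - Δ2) := by rw [hS2]; rfl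
    rw [this]
    exact hcont.preimage_isClosed_of_isClosed isClosed_Ici isClosed_Iic
  have hω2_le : ω (sInf S2) ≤ ω0 - Δ1 - Δ2 := by
    have hmem := hclosed2.csInf_mem hne2 hbdd2
    generalize sInf S2 = u at hmem
    rw [hS2] at hmem
    exact hmem.2
  set t1 := sInf S1
  set t2 := sInf S2
  have ht20 : 0 ≤ t2 := ht10.trans ht12
  have hω1 : ω0 - Δ1 ≤ ω t1 :=
    le_of_forall_lt_of_continuousOn hcont ht10 (by linarith) hbefore1
  have hω2 : ω0 - Δ1 - Δ2 ≤ ω t2 :=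
    le_of_forall_lt_of_continuousOn hcont ht20 (by linarith) hbefore2
  have hcΔ2 : cFun ω0 ε L M ≤ Δ2 := by
    rw [ge_iff_le, div_le_iff₀ (by positivity)] at hinertia
    rw [cFun, div_le_iff₀ (by positivity)]
    linarith
  obtain ⟨σ, hσ, hquad, hσh⟩ :=
    exists_sq_root_limitFun hω0 hMpos hΔ3 hb0 hbL hcΔ2
  set h := limitFun ω0 Δ2 Δ3 ε L M bt
  have hcdef : cFun ω0 ε L M = ω0 / (2 * M) * L * ε := by rw [cFun]; ring
  rw [hcdef] at hcΔ2 hquad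
  set a := ω0 / (2 * M)
  have ha : 0 < a := by positivity
  have hh : 0 < h := by
    by_contra! hle
    have : a * σ ^ 2 * h ≤ 0 := mul_nonpos_of_nonneg_of_nonpos (by positivity) hle
    linarith
  have hwin : ∀ {x y : ℝ}, 0 ≤ x → ContinuousOn ω (Set.Icc x y) := fun hx =>
    hcont.mono fun u hu => hx.trans hu.1
  have hramp : ∀ {u θ : ℝ}, 0 ≤ θ → θ ≤ 1 → θ * h ≤ u - t1 - ε → (L - bt) * θ ≤ p u :=
    fun hθ0 hθ1 hτ => by
      rw [hp]
      exact mul_le_sum_min_ramp hr0 hκ hlimit (by linarith) hθ0 hθ1 hτ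
  have hp0 : ∀ u, 0 ≤ p u := fun u => by
    rw [hp]
    exact Finset.sum_nonneg fun i _ =>
      le_min (mul_nonneg (hκ i).le (le_max_right _ _)) (hr0 i)
  have hlin : ∀ u, HasDerivAt (fun u => -(a * L) * u) (-(a * L)) u := fun u => by
    simpa using (hasDerivAt_id u).const_mul (-(a * L))
  have hffr0 : ∀ u, 0 ≤ ffr u := fun u => by
    rw [hffr]
    split_ifs <;> simp [hb0]
  have hdrop : ∀ y, t1 ≤ y → y ≤ t2 → ω0 - Δ1 - a * L * (y - t1) ≤ ω y := fun y h1 h2 => by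
    have := sub_le_sub_of_hasDerivAt_le h1 (hwin ht10) hlin
      (fun u hu => hswing u (ht10.trans hu.1.le) fun _ => (hu.2.trans_le h2).ne)
      (fun u _ => by nlinarith [mul_nonneg ha.le (hp0 u), mul_nonneg ha.le (hffr0 u)])
    linarith
  have hdelay : t1 + ε ≤ t2 := by
    by_contra! hlt
    have h1 := hdrop t2 ht12 le_rfl
    have h2 : a * L * (t2 - t1) < a * L * ε :=
      mul_lt_mul_of_pos_left (by linarith) (mul_pos ha hL)
    linarith
  have hωdelay := hdrop (t1 + ε) (by linarith) hdelay
  -- the worst-case ramp rate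
  set s := (L - bt) / h with hs_def
  have hs : 0 < s := div_pos (sub_pos.2 hbL) hh
  have hsh : s * h = L - bt := by rw [hs_def]; field_simp
  have hσs : a * σ ^ 2 = 2 * s := by
    apply mul_right_cancel₀ hh.ne'
    linarith
  have hramp' : ∀ {u : ℝ}, t1 + ε ≤ u → u ≤ t1 + ε + h → s * (u - t1 - ε) ≤ p u :=
    fun {u} h1 h2 => by
      have := hramp (u := u) (θ := (u - t1 - ε) / h) (div_nonneg (by linarith) hh.le)
        ((div_le_one hh).2 (by linarith)) (by rw [div_mul_cancel₀ _ hh.ne'])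
      calc s * (u - t1 - ε) = (L - bt) * ((u - t1 - ε) / h) := by rw [hs_def]; ring
        _ ≤ p u := this
  have hquadDeriv : ∀ k u, HasDerivAt (fun u => a / (2 * s) * (s * (u - t1 - ε) - k) ^ 2)
      (a * (s * (u - t1 - ε) - k)) u := fun k u => by
    have h1 : HasDerivAt (fun u => s * (u - t1 - ε) - k) s u := by
      simpa using ((((hasDerivAt_id u).sub_const t1).sub_const ε).const_mul s).sub_const k
    refine ((h1.pow 2).const_mul (a / (2 * s))).congr_deriv ?_
    field_simp
    norm_num
  have hafter : ∀ {x y : ℝ}, t2 ≤ x → t1 + ε + h ≤ x → x ≤ y → ω x ≤ ω y :=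
    fun {x y} h1 h2 hxy => by
      have := sub_le_sub_of_hasDerivAt_le hxy (hwin (ht20.trans h1))
        (fun u => hasDerivAt_const u (0 : ℝ))
        (fun u hu => hswing u (ht20.trans (h1.trans hu.1.le))
          fun _ => (h1.trans_lt hu.1).ne')
        (fun u hu => by
          have h3 := hramp (u := u) (θ := 1) zero_le_one le_rfl (by linarith [hu.1])
          rw [hffr, if_pos (h1.trans hu.1.le)]
          exact mul_nonneg ha.le (by linarith))
      linarith
  rcases lt_or_ge t t2 with htt2 | htt2
  · linarith [hbefore2 t ht htt2]
  rcases le_or_gt (t1 + ε + h) t2 with hslow | hfast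
  · linarith [hafter le_rfl hslow htt2]
  have hbound : a / (2 * s) * (s * (t2 - t1 - ε) - (L - bt)) ^ 2 ≤ Δ3 := by
    have h1 := sub_le_sub_of_hasDerivAt_le hdelay (hwin (by linarith)) (hquadDeriv L)
      (fun u hu => hswing u (by linarith [hu.1]) fun _ => hu.2.ne)
      (fun u hu => mul_le_mul_of_nonneg_left
        (by linarith [hramp' hu.1.le (by linarith [hu.2]), hffr0 u]) ha.le)
    have hw : √Δ3 ^ 2 = Δ3 := Real.sq_sqrt hΔ3.le
    set v := L - bt - s * (t2 - t1 - ε) with hv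
    have hv0 : 0 < v := by
      have : s * (t2 - t1 - ε) < s * h := mul_lt_mul_of_pos_left (by linarith) hs
      linarith
    have hD : (Δ2 - a * L * ε) * σ ^ 2 ≤ L ^ 2 - (bt + v) ^ 2 := by
      have h2 : Δ2 - a * L * ε ≤ a / (2 * s) * (L ^ 2 - (bt + v) ^ 2) := by
        have e1 : s * (t2 - t1 - ε) - L = -(bt + v) := by rw [hv]; ring
        have e2 : s * (t1 + ε - t1 - ε) - L = -L := by ring
        simp only [e1, e2, neg_sq] at h1
        linarith
      calc (Δ2 - a * L * ε) * σ ^ 2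
          ≤ a / (2 * s) * (L ^ 2 - (bt + v) ^ 2) * σ ^ 2 :=
            mul_le_mul_of_nonneg_right h2 (sq_nonneg σ)
        _ = a * σ ^ 2 / (2 * s) * (L ^ 2 - (bt + v) ^ 2) := by ring
        _ = _ := by rw [hσs, div_self (by positivity), one_mul]
    have hle : v ≤ σ * √Δ3 := by
      have h3 : (bt + v) ^ 2 ≤ (bt + σ * √Δ3) ^ 2 := by linarith
      linarith [(sq_le_sq₀ (by positivity) (by positivity)).1 h3]
    calc a / (2 * s) * (s * (t2 - t1 - ε) - (L - bt)) ^ 2 = a / (2 * s) * v ^ 2 := by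
          rw [hv]; ring
      _ ≤ a / (2 * s) * (σ * √Δ3) ^ 2 := by gcongr
      _ = a * σ ^ 2 / (2 * s) * Δ3 := by rw [mul_pow, hw]; ring
      _ = Δ3 := by rw [hσs, div_self (by positivity), one_mul]
  have hmid : ∀ y, t2 ≤ y → y ≤ t1 + ε + h → ωmin ≤ ω y := fun y h1 h2 => by
    have h3 := sub_le_sub_of_hasDerivAt_le h1 (hwin ht20) (hquadDeriv (L - bt))
      (fun u hu => hswing u (ht20.trans hu.1.le) fun _ => hu.1.ne')
      (fun u hu => by
        rw [hffr, if_pos hu.1.le]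
        exact mul_le_mul_of_nonneg_left
          (by linarith [hramp' (u := u) (by linarith [hu.1]) (by linarith [hu.2])]) ha.le)
    have h4 : 0 ≤ a / (2 * s) * (s * (y - t1 - ε) - (L - bt)) ^ 2 := by positivity
    linarith
  rcases le_total t (t1 + ε + h) with hle | hge
  · exact hmid t htt2 hle
  · exact (hmid _ hfast.le le_rfl).trans (hafter hfast.le le_rfl hge)
end

section
/- For every inertia M with M ≥ ε·L·ω0/(2·Δ2) and every b̃ with 0 ≤ b̃ < L, the limit function is well defined and strictly positive: h(M, b̃) > 0. -/
theorem cFun_le_of_le {ω0 Δ2 ε L M : ℝ} (hΔ2 : 0 < Δ2) (hM : 0 < M)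
    (h : ε * L * ω0 / (2 * Δ2) ≤ M) : cFun ω0 ε L M ≤ Δ2 := by
  rw [div_le_iff₀ (by positivity)] at h
  rw [cFun, div_le_iff₀ (by positivity)]
  linarith

/-- The two terms whose difference is squared in the denominator of the limit function, with
`d = Δ2 - c(M)`, are strictly ordered. -/
theorem mul_sqrt_lt_sqrt {d Δ3 L b : ℝ} (hd : 0 ≤ d) (hΔ3 : 0 < Δ3) (hb : 0 ≤ b) (hbL : b < L) :
    b * √Δ3 < √((d + Δ3) * L ^ 2 - d * b ^ 2) := by
  apply Real.lt_sqrt_of_sq_lt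
  rw [mul_pow, Real.sq_sqrt hΔ3.le]
  have hsq : b ^ 2 < L ^ 2 := pow_lt_pow_left₀ hbL hb two_ne_zero
  nlinarith [mul_pos (add_pos_of_nonneg_of_pos hd hΔ3) (sub_pos.2 hsq)]

/-- For every inertia `M ≥ ε·L·ω0/(2·Δ2)` and every `b̃` with `0 ≤ b̃ < L`,
the limit function is well defined and strictly positive: `h(M, b̃) > 0`. -/
theorem limitFun_pos (ω0 Δ2 Δ3 ε L : ℝ)
    (hω0 : 0 < ω0) (hΔ2 : 0 < Δ2) (hΔ3 : 0 < Δ3) (hε : 0 ≤ ε) (hL : 0 < L)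
    (M : ℝ) (hMpos : 0 < M) (hM : M ≥ ε * L * ω0 / (2 * Δ2))
    (b : ℝ) (hb0 : 0 ≤ b) (hbL : b < L) :
    0 < limitFun ω0 Δ2 Δ3 ε L M b := by
  have hc : 0 ≤ Δ2 - cFun ω0 ε L M := sub_nonneg.2 (cFun_le_of_le hΔ2 hMpos hM)
  have hden := mul_sqrt_lt_sqrt hc hΔ3 hb0 hbL
  rw [sub_add_eq_add_sub] at hden
  have hnum : 0 < Δ2 + Δ3 - cFun ω0 ε L M := by linarith
  have hb : 0 < L - b := sub_pos.2 hbL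
  exact div_pos (by positivity) (sq_pos_of_neg (sub_neg.2 hden))
end

section
/- For each fixed inertia M with M ≥ ε·L·ω0/(2·Δ2), the function b̃ ↦ h(M, b̃) is strictly convex on the interval [0, L). -/
theorem ffr_polynomial_pos {x w : ℝ} (hx0 : 0 ≤ x) (hx1 : x < 1) (hxw : x ≤ w) (hw1 : w ≤ 1) :
    0 < (1 - x * w) * (3 * (1 - x) * w ^ 2 - 2 * (1 - x * w) * w) + (1 - x) * (1 - w ^ 2) := by
  have hw0 : 0 ≤ w := hx0.trans hxw
  have key : (1 - x * w) * (3 * (1 - x) * w ^ 2 - 2 * (1 - x * w) * w) + (1 - x) * (1 - w ^ 2)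
      = (1 - w) ^ 4 * (1 + w)
        + (w - x) * ((1 - w) * (2 * w ^ 3 - w ^ 2 + w + 1) + w ^ 3 * (w - x)) := by
    ring
  rw [key]
  have hq : 0 < 2 * w ^ 3 - w ^ 2 + w + 1 := by
    nlinarith [pow_nonneg hw0 3, mul_nonneg hw0 (sub_nonneg.2 hw1)]
  have h1w : 0 ≤ 1 - w := sub_nonneg.2 hw1
  have hwx : 0 ≤ w - x := sub_nonneg.2 hxw
  rcases hw1.lt_or_eq with h | rfl
  · have : 0 < 1 - w := sub_pos.2 h
    positivity
  · have : 0 < 1 - x := sub_pos.2 hx1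
    nlinarith [mul_pos this this]

theorem ffr_sq_pos {p r x : ℝ} (hp : 0 ≤ p) (hr : 0 < r) (hpr : p + r ^ 2 = 1)
    (hx0 : 0 ≤ x) (hx1 : x < 1) : 0 < 1 - p * x ^ 2 := by
  nlinarith [mul_nonneg hp (sub_nonneg.2 (pow_le_one₀ hx0 hx1.le : x ^ 2 ≤ 1)), pow_pos hr 2]

theorem ffr_gap_pos {p r x : ℝ} (hpr : p + r ^ 2 = 1)
    (hx0 : 0 ≤ x) (hx1 : x < 1) : 0 < √(1 - p * x ^ 2) - x * r := by
  rw [sub_pos]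
  apply Real.lt_sqrt_of_sq_lt
  nlinarith

theorem ffr_secondDeriv_numerator_pos {p r x S : ℝ} (hp : 0 ≤ p) (hr : 0 < r)
    (hpr : p + r ^ 2 = 1) (hx0 : 0 ≤ x) (hx1 : x < 1) (hS : 0 < S) (hS2 : S ^ 2 = 1 - p * x ^ 2)
    (hn : 0 < S - x * r) :
    0 < 3 * (1 - x) * (-(p * x / S) - r) ^ 2 + 2 * (S - x * r) * (-(p * x / S) - r)
      - (1 - x) * (S - x * r) * (-(p / S ^ 3)) := by
  set n := S - x * r with hn_def
  set w := r * S + p * x with hw_def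
  have hnS : n * S = 1 - x * w := by rw [hn_def, hw_def]; linear_combination hS2
  have hwx : w = x + r * n := by rw [hn_def, hw_def]; linear_combination x * hpr
  have hpn : p * n ^ 2 = 1 - w ^ 2 := by
    rw [hn_def, hw_def]
    linear_combination (p + r ^ 2) * hS2 + hpr
  have hxw : x ≤ w := by rw [hwx]; nlinarith [mul_pos hr hn]
  have hw1 : w ≤ 1 := by nlinarith [mul_nonneg hp (sq_nonneg n)]
  have hF := ffr_polynomial_pos hx0 hx1 hxw hw1
  rw [← hnS, ← hpn] at hF
  have : 3 * (1 - x) * (-(p * x / S) - r) ^ 2 + 2 * n * (-(p * x / S) - r)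
      - (1 - x) * n * (-(p / S ^ 3))
      = (n * S * (3 * (1 - x) * w ^ 2 - 2 * (n * S) * w) + (1 - x) * (p * n ^ 2))
        / (n * S ^ 3) := by
    rw [hw_def]
    field_simp
    ring
  rw [this]
  positivity

theorem hasDerivAt_ffr_gap {p r x : ℝ} (h : 0 < 1 - p * x ^ 2) :
    HasDerivAt (fun y : ℝ => √(1 - p * y ^ 2) - y * r) (-(p * x / √(1 - p * x ^ 2)) - r) x := by
  have h1 : HasDerivAt (fun y : ℝ => 1 - p * y ^ 2) (-(p * (2 * x))) x := by
    simpa using ((hasDerivAt_pow 2 x).const_mul p).const_sub 1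
  have h2 := (h1.sqrt h.ne').sub ((hasDerivAt_id x).mul_const r)
  refine h2.congr_deriv ?_
  have := (Real.sqrt_pos.2 h).ne'
  field_simp

theorem hasDerivAt_ffr_gap_deriv {p r x : ℝ} (h : 0 < 1 - p * x ^ 2) :
    HasDerivAt (fun y : ℝ => -(p * y / √(1 - p * y ^ 2)) - r) (-(p / √(1 - p * x ^ 2) ^ 3)) x := by
  have h1 : HasDerivAt (fun y : ℝ => 1 - p * y ^ 2) (-(p * (2 * x))) x := by
    simpa using ((hasDerivAt_pow 2 x).const_mul p).const_sub 1
  have hS := Real.sqrt_pos.2 h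
  have h2 := ((((hasDerivAt_id x).const_mul p).div (h1.sqrt h.ne') hS.ne').neg).sub_const r
  refine h2.congr_deriv ?_
  have hS2 := Real.sq_sqrt h.le
  simp only [id]
  field_simp
  rw [hS2]
  ring

theorem strictConvexOn_normalized_ffr {p r : ℝ} (hp : 0 ≤ p) (hr : 0 < r)
    (hpr : p + r ^ 2 = 1) :
    StrictConvexOn ℝ (Set.Ico (0 : ℝ) 1)
      (fun x => (1 - x) / (√(1 - p * x ^ 2) - x * r) ^ 2) := by
  have hd1 : ∀ x ∈ Set.Ico (0 : ℝ) 1,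
      HasDerivAt (fun x => (1 - x) / (√(1 - p * x ^ 2) - x * r) ^ 2)
        ((-(√(1 - p * x ^ 2) - x * r) - 2 * (1 - x) * (-(p * x / √(1 - p * x ^ 2)) - r))
          / (√(1 - p * x ^ 2) - x * r) ^ 3) x := by
    rintro x ⟨hx0, hx1⟩
    have hn := ffr_gap_pos hpr hx0 hx1
    have h := ((hasDerivAt_id x).const_sub 1).div
      ((hasDerivAt_ffr_gap (r := r) (ffr_sq_pos hp hr hpr hx0 hx1)).pow 2) (pow_pos hn 2).ne'
    refine h.congr_deriv ?_
    simp only [id, Pi.pow_apply]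
    generalize -(p * x / √(1 - p * x ^ 2)) - r = g1
    generalize √(1 - p * x ^ 2) - x * r = g at hn
    have := hn.ne'
    field_simp
    ring
  apply strictConvexOn_of_deriv2_pos (convex_Ico 0 1)
  · exact fun x hx => (hd1 x hx).continuousAt.continuousWithinAt
  · intro x hx
    rw [interior_Ico] at hx
    obtain ⟨hx0, hx1⟩ := hx
    have hs := ffr_sq_pos hp hr hpr hx0.le hx1
    have hn := ffr_gap_pos hpr hx0.le hx1
    have hev : deriv (fun x => (1 - x) / (√(1 - p * x ^ 2) - x * r) ^ 2) =ᶠ[nhds x]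
        fun x => (-(√(1 - p * x ^ 2) - x * r)
          - 2 * (1 - x) * (-(p * x / √(1 - p * x ^ 2)) - r))
          / (√(1 - p * x ^ 2) - x * r) ^ 3 := by
      filter_upwards [Ioo_mem_nhds hx0 hx1] with y hy
      exact (hd1 y ⟨hy.1.le, hy.2⟩).deriv
    rw [Function.iterate_succ, Function.iterate_one, Function.comp_apply, hev.deriv_eq]
    have hg := hasDerivAt_ffr_gap (r := r) hs
    have h := (hg.neg.sub ((((hasDerivAt_id x).const_sub 1).const_mul 2).mul
      (hasDerivAt_ffr_gap_deriv (r := r) hs))).div (hg.pow 3) (pow_pos hn 3).ne'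
    have hval := ffr_secondDeriv_numerator_pos hp hr hpr hx0.le hx1 (Real.sqrt_pos.2 hs)
      (Real.sq_sqrt hs.le) hn
    refine lt_of_lt_of_eq (b := 2 * (3 * (1 - x) * (-(p * x / √(1 - p * x ^ 2)) - r) ^ 2
      + 2 * (√(1 - p * x ^ 2) - x * r) * (-(p * x / √(1 - p * x ^ 2)) - r)
      - (1 - x) * (√(1 - p * x ^ 2) - x * r) * (-(p / √(1 - p * x ^ 2) ^ 3)))
      / (√(1 - p * x ^ 2) - x * r) ^ 4) (by positivity) ?_
    refine Eq.trans ?_ h.deriv.symm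
    simp only [id, Pi.pow_apply, Pi.neg_apply, Pi.sub_apply, Pi.mul_apply]
    generalize -(p / √(1 - p * x ^ 2) ^ 3) = g2
    generalize -(p * x / √(1 - p * x ^ 2)) - r = g1
    generalize √(1 - p * x ^ 2) - x * r = g at hn
    have := hn.ne'
    field_simp
    ring

theorem limitFun_eq_const_mul_normalized {ω0 Δ2 Δ3 ε L M : ℝ} (hΔ3 : 0 < Δ3) (hL : 0 < L)
    (hc : cFun ω0 ε L M ≤ Δ2) (b : ℝ) :
    limitFun ω0 Δ2 Δ3 ε L M b =
      (4 * M / ω0) * (Δ2 + Δ3 - cFun ω0 ε L M) / L *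
        ((1 - b / L) / (√(1 - (Δ2 - cFun ω0 ε L M) / (Δ2 + Δ3 - cFun ω0 ε L M) * (b / L) ^ 2)
          - b / L * (√Δ3 / √(Δ2 + Δ3 - cFun ω0 ε L M))) ^ 2) := by
  unfold limitFun
  generalize cFun ω0 ε L M = c at hc ⊢
  set A := Δ2 + Δ3 - c with hA_def
  have hA : 0 < A := by linarith
  have hsA := Real.sqrt_pos.2 hA
  have hsqrt : √(A * L ^ 2 - (Δ2 - c) * b ^ 2)
      = √A * L * √(1 - (Δ2 - c) / A * (b / L) ^ 2) := by
    rw [show A * L ^ 2 - (Δ2 - c) * b ^ 2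
        = A * L ^ 2 * (1 - (Δ2 - c) / A * (b / L) ^ 2) by field_simp,
      Real.sqrt_mul (by positivity), Real.sqrt_mul hA.le, Real.sqrt_sq hL.le]
  rw [hsqrt]
  generalize √(1 - (Δ2 - c) / A * (b / L) ^ 2) = S
  have hden : (b * √Δ3 - √A * L * S) ^ 2 = A * L ^ 2 * (S - b / L * (√Δ3 / √A)) ^ 2 := by
    have hAA := Real.sq_sqrt hA.le
    calc _ = (√A) ^ 2 * L ^ 2 * (S - b / L * (√Δ3 / √A)) ^ 2 := by field_simp; ring
      _ = _ := by rw [hAA]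
  rw [hden]
  generalize (S - b / L * (√Δ3 / √A)) ^ 2 = D
  rw [show (1 - b / L) = (L - b) / L by field_simp]
  have := hA.ne'
  field_simp

/-- For each fixed inertia `M ≥ ε·L·ω0/(2·Δ2)`, the function `b̃ ↦ h(M, b̃)` is
strictly convex on the interval `[0, L)`. -/
theorem limitFun_strictConvexOn_ffr (ω0 Δ2 Δ3 ε L : ℝ)
    (hω0 : 0 < ω0) (hΔ2 : 0 < Δ2) (hΔ3 : 0 < Δ3) (hε : 0 ≤ ε) (hL : 0 < L)
    (M : ℝ) (hMpos : 0 < M) (hM : M ≥ ε * L * ω0 / (2 * Δ2)) :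
    StrictConvexOn ℝ (Set.Ico (0 : ℝ) L) (fun b => limitFun ω0 Δ2 Δ3 ε L M b) := by
  have hc : cFun ω0 ε L M ≤ Δ2 := by
    unfold cFun
    rw [ge_iff_le, div_le_iff₀ (by positivity)] at hM
    rw [div_le_iff₀ (by positivity)]
    linarith
  simp only [limitFun_eq_const_mul_normalized hΔ3 hL hc]
  generalize cFun ω0 ε L M = c at hc ⊢
  have hA : 0 < Δ2 + Δ3 - c := by linarith
  have hf := strictConvexOn_normalized_ffr (p := (Δ2 - c) / (Δ2 + Δ3 - c))
    (r := √Δ3 / √(Δ2 + Δ3 - c)) (div_nonneg (by linarith) hA.le)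
    (div_pos (Real.sqrt_pos.2 hΔ3) (Real.sqrt_pos.2 hA))
    (by rw [div_pow, Real.sq_sqrt hΔ3.le, Real.sq_sqrt hA.le]; field_simp; ring)
  have hK : 0 < 4 * M / ω0 * (Δ2 + Δ3 - c) / L := by positivity
  have hmem : ∀ b ∈ Set.Ico (0 : ℝ) L, b / L ∈ Set.Ico (0 : ℝ) 1 := fun b hb =>
    ⟨div_nonneg hb.1 hL.le, (div_lt_one hL).2 hb.2⟩
  refine ⟨convex_Ico 0 L, fun x hx y hy hxy a b ha hb hab => ?_⟩
  have h := hf.2 (hmem x hx) (hmem y hy) (fun h => hxy ((div_left_inj' hL.ne').1 h)) ha hb hab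
  have h' := mul_lt_mul_of_pos_left h hK
  simp only [smul_eq_mul] at h' ⊢
  rw [show a * (x / L) + b * (y / L) = (a * x + b * y) / L by ring] at h'
  exact h'.trans_eq (by ring)
end

section
/- Necessity of the general reserve requirement: in the dynamic model, if the total reserve is insufficient to cover the outage, i.e. r_1 + … + r_n + b̃ < L, then the frequency trajectory is unbounded below; in particular there exists t ≥ 0 with ω(t) < ω_min. -/
open scoped Classical

/-- A continuous function on `[a, ∞)` whose derivative is at most `-c` away from one point of
`[a, ∞)` decreases at least linearly with rate `c`. -/
theorem le_sub_mul_of_hasDerivAt_le_of_ne {f f' : ℝ → ℝ} {a b c : ℝ} (hab : a ≤ b)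
    (hf : ContinuousOn f (Set.Ici a))
    (hderiv : ∀ t, a < t → t ≠ b → HasDerivAt f (f' t) t ∧ f' t ≤ -c) {t : ℝ} (ht : a ≤ t) :
    f t ≤ f a - c * (t - a) := by
  have hcont : ContinuousOn (fun x => f x + c * x) (Set.Ici a) := by fun_prop
  have hd : ∀ x, a < x → x ≠ b → HasDerivAt (fun x => f x + c * x) (f' x + c) x := by
    intro x hx hxb
    exact (hderiv x hx hxb).1.fun_add (hasDerivAt_const_mul c)
  have hleft : AntitoneOn (fun x => f x + c * x) (Set.Icc a b) := by
    refine antitoneOn_of_hasDerivWithinAt_nonpos (f' := fun x => f' x + c) (convex_Icc a b)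
      (hcont.mono Set.Icc_subset_Ici_self) ?_ ?_ <;> intro x hx <;> rw [interior_Icc] at hx
    · exact (hd x hx.1 hx.2.ne).hasDerivWithinAt
    · linarith [(hderiv x hx.1 hx.2.ne).2]
  have hright : AntitoneOn (fun x => f x + c * x) (Set.Ici b) := by
    refine antitoneOn_of_hasDerivWithinAt_nonpos (f' := fun x => f' x + c) (convex_Ici b)
      (hcont.mono (Set.Ici_subset_Ici.2 hab)) ?_ ?_ <;> intro x hx <;>
      rw [interior_Ici, Set.mem_Ioi] at hx
    · exact (hd x (hab.trans_lt hx) hx.ne').hasDerivWithinAt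
    · linarith [(hderiv x (hab.trans_lt hx) hx.ne').2]
  have hanti := hleft.union_right hright (isGreatest_Icc hab) isLeast_Ici
  rw [Set.Icc_union_Ici_eq_Ici hab] at hanti
  have := hanti Set.self_mem_Ici (Set.mem_Ici.2 ht) ht
  simp only at this
  linarith

/-- Necessity of the general reserve requirement.  In the dynamic model, if
the total reserve is insufficient to cover the outage (`Σᵢ rᵢ + b̃ < L`), then the frequency
trajectory is unbounded below on `[0, ∞)`; in particular there exists `t ≥ 0` with
`ω(t) < ω_min`.

The dynamic model: `ω(0) = ω0`; `t1 = sInf S1` where `S1 = {t ≥ 0 | ω(t) ≤ ω0 − Δ1}` and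
`t2 = sInf S2` where `S2 = {t ≥ 0 | ω(t) ≤ ω0 − Δ1 − Δ2}` (with `inf ∅ = +∞`, encoded by
branching on nonemptiness); the deployed PFR is
`p(t) = Σᵢ min(κᵢ·max(t − t1 − ε, 0), rᵢ)` (and `0` while the dead-band has never been
reached); and for every `t ≥ 0` with `t ≠ t2`, the swing equation
`ω'(t) = (ω0/(2M))·(p(t) + b̃·1[t ≥ t2] − L)` holds. -/
theorem insufficient_reserve_frequency_unbounded_below
    (ω0 Δ1 Δ2 ωmin ε L M bt : ℝ) (n : ℕ) (r κ : Fin n → ℝ) (ω : ℝ → ℝ)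
    (hω0 : 0 < ω0) (hΔ1 : 0 ≤ Δ1) (hΔ2 : 0 < Δ2)
    (hΔ3 : 0 < ω0 - Δ1 - Δ2 - ωmin) (hε : 0 ≤ ε) (hL : 0 < L) (hMpos : 0 < M)
    (hr0 : ∀ i, 0 ≤ r i) (hκ : ∀ i, 0 < κ i) (hb0 : 0 ≤ bt)
    (hinit : ω 0 = ω0) (hcont : ContinuousOn ω (Set.Ici 0))
    (S1 S2 : Set ℝ)
    (hS1 : S1 = {t : ℝ | 0 ≤ t ∧ ω t ≤ ω0 - Δ1})
    (hS2 : S2 = {t : ℝ | 0 ≤ t ∧ ω t ≤ ω0 - Δ1 - Δ2})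
    (p : ℝ → ℝ)
    (hp : ∀ t : ℝ, p t =
      if S1.Nonempty then ∑ i, min (κ i * max (t - sInf S1 - ε) 0) (r i) else 0)
    (ffr : ℝ → ℝ)
    (hffr : ∀ t : ℝ, ffr t = if S2.Nonempty ∧ sInf S2 ≤ t then bt else 0)
    (hswing : ∀ t : ℝ, 0 ≤ t → (S2.Nonempty → t ≠ sInf S2) →
      HasDerivAt ω (ω0 / (2 * M) * (p t + ffr t - L)) t)
    (hshort : (∑ i, r i) + bt < L) :
    (¬ BddBelow (ω '' Set.Ici (0 : ℝ))) ∧ ∃ t : ℝ, 0 ≤ t ∧ ω t < ωmin := by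
  set c : ℝ := ω0 / (2 * M) * (L - ((∑ i, r i) + bt)) with hc
  have hk : 0 < ω0 / (2 * M) := by positivity
  have hcpos : 0 < c := mul_pos hk (by linarith)
  have hp_le (t : ℝ) : p t ≤ ∑ i, r i := by
    rw [hp]
    split_ifs
    · exact Finset.sum_le_sum fun i _ => min_le_right _ _
    · exact Finset.sum_nonneg fun i _ => hr0 i
  have hffr_le (t : ℝ) : ffr t ≤ bt := by
    rw [hffr]
    split_ifs
    · exact le_rfl
    · exact hb0
  have hS2_nonneg : 0 ≤ sInf S2 := Real.sInf_nonneg fun t ht => by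
    rw [hS2] at ht
    exact ht.1
  have hbound (t : ℝ) (ht : 0 ≤ t) : ω t ≤ ω0 - c * t := by
    have := le_sub_mul_of_hasDerivAt_le_of_ne (c := c) hS2_nonneg hcont
      (fun s hs hne => ⟨hswing s hs.le fun _ => hne, by
        rw [hc, ← mul_neg]
        exact mul_le_mul_of_nonneg_left (by linarith [hp_le s, hffr_le s]) hk.le⟩) ht
    simpa [hinit] using this
  have hbelow (B : ℝ) : ∃ t : ℝ, 0 ≤ t ∧ ω t < B := by
    have ht : 0 ≤ |ω0 - B| / c + 1 := by positivity
    refine ⟨_, ht, (hbound _ ht).trans_lt ?_⟩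
    rw [mul_add, mul_div_cancel₀ _ hcpos.ne']
    linarith [le_abs_self (ω0 - B)]
  refine ⟨?_, hbelow ωmin⟩
  rintro ⟨B, hB⟩
  obtain ⟨t, ht, hlt⟩ := hbelow B
  exact hlt.not_ge (hB ⟨t, ht, rfl⟩)
end
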